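/- Let M, N, K be positive integers, A ∈ ℝ^{M×N}, P ∈ ℝ^{M×K}, Q ∈ ℝ^{K×N}, and θ > 0. Set c₁ = 3 and c₂ = ‖A‖_F. Let E₁ ∈ ℝ^{M×K} and E₂ ∈ ℝ^{K×N} be all-ones matrices. Define F(U,Z) = θ(‖U‖₁ + ‖Z‖₁) + ⟨P,U⟩_F + ⟨Q,Z⟩_F + c₁·((‖U‖_F² + ‖Z‖_F²)/2)² + c₂·(‖U‖_F² + ‖Z‖_F²)/2. If r ≥ 0 satisfies c₁(‖Π₊(−(P + θE₁))‖_F² + ‖Π₊(−(Q + θE₂))‖_F²)·r³ + c₂·r − 1 = 0, then (U*, Z*) = (r·Π₊(−(P + θE₁)), r·Π₊(−(Q + θE₂))) minimizes F over the set {(U,Z) : U ≥ 0, Z ≥ 0}. -/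

import Mathlib

/-- Frobenius inner product of real matrices. -/
noncomputable def fip {m n : ℕ} (X Y : Matrix (Fin m) (Fin n) ℝ) : ℝ :=
  ∑ i, ∑ j, X i j * Y i j

/-- Frobenius norm of a real matrix. -/
noncomputable def fnorm {m n : ℕ} (X : Matrix (Fin m) (Fin n) ℝ) : ℝ :=
  Real.sqrt (fip X X)

/-- Entrywise ℓ1 norm of a real matrix. -/
noncomputable def l1 {m n : ℕ} (X : Matrix (Fin m) (Fin n) ℝ) : ℝ :=
  ∑ i, ∑ j, |X i j|

/-- Entrywise positive part Π₊. -/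
def pp {m n : ℕ} (Y : Matrix (Fin m) (Fin n) ℝ) : Matrix (Fin m) (Fin n) ℝ :=
  fun i j => max (Y i j) 0

/-- The all-ones matrix. -/
def onesM (m n : ℕ) : Matrix (Fin m) (Fin n) ℝ := fun _ _ => 1

theorem fnorm_sq {m n : ℕ} (X : Matrix (Fin m) (Fin n) ℝ) : fnorm X ^ 2 = fip X X :=
  Real.sq_sqrt (Finset.sum_nonneg fun _ _ => Finset.sum_nonneg fun _ _ => mul_self_nonneg _)

theorem fnorm_smul_sq {m n : ℕ} (r : ℝ) (X : Matrix (Fin m) (Fin n) ℝ) :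
    fnorm (r • X) ^ 2 = r ^ 2 * fnorm X ^ 2 := by
  simp only [fnorm_sq, fip, Finset.mul_sum, Matrix.smul_apply, smul_eq_mul]
  exact Finset.sum_congr rfl fun i _ => Finset.sum_congr rfl fun j _ => by ring

/-- The linear part of the objective along the soft-thresholded direction. -/
theorem l1_add_fip_smul_pp {m n : ℕ} (P : Matrix (Fin m) (Fin n) ℝ) (θ : ℝ) {r : ℝ}
    (hr : 0 ≤ r) :
    θ * l1 (r • pp (-(P + θ • onesM m n))) + fip P (r • pp (-(P + θ • onesM m n))) =
      -r * fnorm (pp (-(P + θ • onesM m n))) ^ 2 := by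
  simp only [fnorm_sq, fip, l1, Finset.mul_sum, ← Finset.sum_add_distrib]
  refine Finset.sum_congr rfl fun i _ => Finset.sum_congr rfl fun j _ => ?_
  simp only [pp, onesM, Matrix.smul_apply, Matrix.neg_apply, Matrix.add_apply, smul_eq_mul,
    mul_one]
  rw [abs_of_nonneg (mul_nonneg hr (le_max_right _ _))]
  rcases max_cases (-(P i j + θ)) 0 with ⟨h, _⟩ | ⟨h, _⟩ <;> rw [h] <;> ring

/-- Lower bound for the linear part of the objective on nonnegative matrices. -/
theorem neg_le_l1_add_fip {m n : ℕ} (P U : Matrix (Fin m) (Fin n) ℝ) (θ : ℝ) {r k : ℝ}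
    (hk : 0 ≤ k) (hkr : k * r = 1) (hU : ∀ i j, 0 ≤ U i j) :
    -(k / 2 * (r ^ 2 * fnorm (pp (-(P + θ • onesM m n))) ^ 2 + fnorm U ^ 2)) ≤
      θ * l1 U + fip P U := by
  simp only [fnorm_sq, fip, l1, Finset.mul_sum, ← Finset.sum_add_distrib,
    ← Finset.sum_neg_distrib]
  refine Finset.sum_le_sum fun i _ => Finset.sum_le_sum fun j _ => ?_
  simp only [pp, onesM, Matrix.smul_apply, Matrix.neg_apply, Matrix.add_apply, smul_eq_mul,
    mul_one]
  rw [abs_of_nonneg (hU i j)]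
  have hv := mul_le_mul_of_nonneg_right (le_max_left (-(P i j + θ)) 0) (hU i j)
  set v := max (-(P i j + θ)) 0
  have hsq := mul_nonneg hk (sq_nonneg (r * v - U i j))
  have hkv : k * r * (v * U i j) = v * U i j := by rw [hkr, one_mul]
  nlinarith

/-- if r ≥ 0 solves
3(‖Π₊(−(P+θE₁))‖²+‖Π₊(−(Q+θE₂))‖²)r³ + ‖A‖_F r − 1 = 0, then
(U*,Z*) = (r·Π₊(−(P+θE₁)), r·Π₊(−(Q+θE₂))) minimizes the ℓ1-regularized BPG subproblem
F(U,Z) = θ(‖U‖₁+‖Z‖₁) + ⟨P,U⟩ + ⟨Q,Z⟩ + 3((‖U‖²+‖Z‖²)/2)² + ‖A‖_F(‖U‖²+‖Z‖²)/2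
over entrywise nonnegative pairs (U,Z). -/
theorem stmt15 (M N K : ℕ) (hM : 0 < M) (hN : 0 < N) (hK : 0 < K)
    (A : Matrix (Fin M) (Fin N) ℝ)
    (P : Matrix (Fin M) (Fin K) ℝ) (Q : Matrix (Fin K) (Fin N) ℝ)
    (θ : ℝ) (hθ : 0 < θ) (r : ℝ) (hr : 0 ≤ r)
    (hcubic : 3 * (fnorm (pp (-(P + θ • onesM M K))) ^ 2 +
        fnorm (pp (-(Q + θ • onesM K N))) ^ 2) * r ^ 3 +
      fnorm A * r - 1 = 0) :
    (∀ i j, 0 ≤ (r • pp (-(P + θ • onesM M K))) i j) ∧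
    (∀ i j, 0 ≤ (r • pp (-(Q + θ • onesM K N))) i j) ∧
    ∀ (U : Matrix (Fin M) (Fin K) ℝ) (Z : Matrix (Fin K) (Fin N) ℝ),
      (∀ i j, 0 ≤ U i j) → (∀ i j, 0 ≤ Z i j) →
      θ * (l1 (r • pp (-(P + θ • onesM M K))) + l1 (r • pp (-(Q + θ • onesM K N)))) +
          fip P (r • pp (-(P + θ • onesM M K))) + fip Q (r • pp (-(Q + θ • onesM K N))) +
          3 * ((fnorm (r • pp (-(P + θ • onesM M K))) ^ 2 +
                fnorm (r • pp (-(Q + θ • onesM K N))) ^ 2) / 2) ^ 2 +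
          fnorm A * ((fnorm (r • pp (-(P + θ • onesM M K))) ^ 2 +
                fnorm (r • pp (-(Q + θ • onesM K N))) ^ 2) / 2) ≤
        θ * (l1 U + l1 Z) + fip P U + fip Q Z +
          3 * ((fnorm U ^ 2 + fnorm Z ^ 2) / 2) ^ 2 +
          fnorm A * ((fnorm U ^ 2 + fnorm Z ^ 2) / 2) := by
  have hnn : ∀ {m n : ℕ} (Y : Matrix (Fin m) (Fin n) ℝ) (i j), 0 ≤ (r • pp Y) i j :=
    fun Y i j => mul_nonneg hr (le_max_right _ _)
  refine ⟨hnn _, hnn _, fun U Z hU hZ => ?_⟩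
  have hA : 0 ≤ fnorm A := Real.sqrt_nonneg _
  have hP := l1_add_fip_smul_pp P θ hr
  have hQ := l1_add_fip_smul_pp Q θ hr
  have hPU := fun k hk hkr => neg_le_l1_add_fip (r := r) (k := k) P U θ hk hkr hU
  have hQZ := fun k hk hkr => neg_le_l1_add_fip (r := r) (k := k) Q Z θ hk hkr hZ
  simp only [fnorm_smul_sq]
  have hv := sq_nonneg (fnorm (pp (-(P + θ • onesM M K))))
  have hw := sq_nonneg (fnorm (pp (-(Q + θ • onesM K N))))
  generalize fnorm (pp (-(P + θ • onesM M K))) ^ 2 = v at *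
  generalize fnorm (pp (-(Q + θ • onesM K N))) ^ 2 = w at *
  obtain ⟨k, hk⟩ : ∃ k, k = 3 * (r ^ 2 * (v + w)) + fnorm A := ⟨_, rfl⟩
  have hk0 : 0 ≤ k := by rw [hk]; positivity
  have hkr : k * r = 1 := by rw [hk]; linarith
  have h1 := hPU k hk0 hkr
  have h2 := hQZ k hk0 hkr
  have hr2 : r = k * r ^ 2 := by linear_combination -r * hkr
  have hrS : r * (v + w) = k * (r ^ 2 * (v + w)) := by linear_combination (v + w) * hr2
  have hsq := sq_nonneg (fnorm U ^ 2 + fnorm Z ^ 2 - r ^ 2 * (v + w))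
  generalize fnorm U ^ 2 = a at *
  generalize fnorm Z ^ 2 = b at *
  subst hk
  linarith
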